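/- arXiv:1812.08461 — 2 statements merged into one kernel-verified Lean document; each statement's English description precedes it below -/
import Mathlib

section
/- Jacobi identity for the polarized Poisson bracket: for smooth a, b, a', b', a'', b'', writing H = H_{a,b}, K = H_{a',b'}, L = H_{a'',b''} and {H, K}_p(m) = −θ_p(X_{a,b}(m), X_{a',b'}(m)) (which is again a polarized Hamiltonian of the same form, so the bracket can be iterated), one has {{H, K}, L} + {{K, L}, H} + {{L, H}, K} = 0 as functions E → (Fin k → ℝ). -/
noncomputable section

/-- The model polarized k-symplectic space `E = (ℝ^n)^k × ℝ^n`. -/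
abbrev E (k n : ℕ) : Type := (Fin k → Fin n → ℝ) × (Fin n → ℝ)

/-- The components `θ_p` of the canonical polarized k-symplectic form:
`θ_p((x,y),(x',y')) = Σ_i (x p i * y' i − x' p i * y i)`. -/
def theta (k n : ℕ) (p : Fin k) (w v : E k n) : ℝ :=
  ∑ i, (w.1 p i * v.2 i - v.1 p i * w.2 i)

/-- The polarized Hamiltonian `H_{a,b}(x,y) p = Σ_j a j (y) * x p j + b p (y)`. -/
def Ham {k n : ℕ} (a : (Fin n → ℝ) → (Fin n → ℝ)) (b : (Fin n → ℝ) → (Fin k → ℝ))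
    (m : E k n) : Fin k → ℝ :=
  fun p => ∑ j, a m.2 j * m.1 p j + b m.2 p

/-- The polarized Hamiltonian vector field `X_{a,b}`, with first component
`(p,s) ↦ −(Σ_j x p j * ∂a_j/∂y_s(y) + ∂b_p/∂y_s(y))` and second component `i ↦ a i (y)`. -/
def HamVF {k n : ℕ} (a : (Fin n → ℝ) → (Fin n → ℝ)) (b : (Fin n → ℝ) → (Fin k → ℝ))
    (m : E k n) : E k n :=
  (fun p s => -((∑ j, m.1 p j * fderiv ℝ a m.2 (Pi.single s 1) j)
      + fderiv ℝ b m.2 (Pi.single s 1) p),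
   fun i => a m.2 i)

/-- The Lie bracket of vector fields `[X,Y](m) = (fderiv ℝ Y m)(X m) − (fderiv ℝ X m)(Y m)`. -/
def lieBracketVF {k n : ℕ} (X Y : E k n → E k n) (m : E k n) : E k n :=
  fderiv ℝ Y m (X m) - fderiv ℝ X m (Y m)

/-- x-coefficients of the polarized Poisson bracket `{H_{a,b}, H_{a',b'}}`. -/
def pbA {n : ℕ} (a a' : (Fin n → ℝ) → (Fin n → ℝ)) : (Fin n → ℝ) → (Fin n → ℝ) :=
  fun y j => ∑ i, (a' y i * fderiv ℝ a y (Pi.single i 1) j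
    - a y i * fderiv ℝ a' y (Pi.single i 1) j)

/-- y-coefficients of the polarized Poisson bracket `{H_{a,b}, H_{a',b'}}`. -/
def pbB {k n : ℕ} (a : (Fin n → ℝ) → (Fin n → ℝ)) (b : (Fin n → ℝ) → (Fin k → ℝ))
    (a' : (Fin n → ℝ) → (Fin n → ℝ)) (b' : (Fin n → ℝ) → (Fin k → ℝ)) :
    (Fin n → ℝ) → (Fin k → ℝ) :=
  fun y p => ∑ i, (a' y i * fderiv ℝ b y (Pi.single i 1) p
    - a y i * fderiv ℝ b' y (Pi.single i 1) p)

theorem sum_mul_apply_single {n k : ℕ} (T : (Fin n → ℝ) →L[ℝ] (Fin k → ℝ)) (v : Fin n → ℝ)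
    (p : Fin k) : ∑ i, v i * T (Pi.single i 1) p = T v p := by
  conv_rhs => rw [pi_eq_sum_univ' v]
  simp [map_sum, Finset.sum_apply]

theorem pbB_eq {k n : ℕ} (a a' : (Fin n → ℝ) → (Fin n → ℝ)) (b b' : (Fin n → ℝ) → (Fin k → ℝ)) :
    pbB a b a' b' = fun y => fderiv ℝ b y (a' y) - fderiv ℝ b' y (a y) := by
  funext y p
  simp only [pbB, Finset.sum_sub_distrib, sum_mul_apply_single, Pi.sub_apply]

theorem pbA_eq_pbB {n : ℕ} (a a' : (Fin n → ℝ) → (Fin n → ℝ)) : pbA a a' = pbB a a a' a' := rfl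

theorem fderiv_pbB_apply {k n : ℕ} {a a' : (Fin n → ℝ) → (Fin n → ℝ)}
    {b b' : (Fin n → ℝ) → (Fin k → ℝ)} (ha : ContDiff ℝ 2 a) (hb : ContDiff ℝ 2 b)
    (ha' : ContDiff ℝ 2 a') (hb' : ContDiff ℝ 2 b') (y v : Fin n → ℝ) :
    fderiv ℝ (pbB a b a' b') y v =
      (fderiv ℝ (fderiv ℝ b) y v (a' y) + fderiv ℝ b y (fderiv ℝ a' y v))
        - (fderiv ℝ (fderiv ℝ b') y v (a y) + fderiv ℝ b' y (fderiv ℝ a y v)) := by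
  have key : ∀ {c : (Fin n → ℝ) → (Fin n → ℝ)} {f : (Fin n → ℝ) → (Fin k → ℝ)},
      ContDiff ℝ 2 c → ContDiff ℝ 2 f →
      HasFDerivAt (fun y => fderiv ℝ f y (c y))
        ((fderiv ℝ f y).comp (fderiv ℝ c y) + (fderiv ℝ (fderiv ℝ f) y).flip (c y)) y := by
    intro c f hc hf
    have hf' : Differentiable ℝ (fderiv ℝ f) :=
      (hf.fderiv_right (m := 1) (by norm_num)).differentiable (by norm_num)
    exact (hf' y).hasFDerivAt.clm_apply ((hc.differentiable (by norm_num)) y).hasFDerivAt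
  rw [pbB_eq, ((key ha' hb).fun_sub (key ha hb')).fderiv]
  simp [add_comm]

theorem pbB_jacobi {k n : ℕ} {a a' a'' : (Fin n → ℝ) → (Fin n → ℝ)}
    {b b' b'' : (Fin n → ℝ) → (Fin k → ℝ)} (ha : ContDiff ℝ 2 a) (hb : ContDiff ℝ 2 b)
    (ha' : ContDiff ℝ 2 a') (hb' : ContDiff ℝ 2 b')
    (ha'' : ContDiff ℝ 2 a'') (hb'' : ContDiff ℝ 2 b'') (y : Fin n → ℝ) :
    pbB (pbA a a') (pbB a b a' b') a'' b'' y + pbB (pbA a' a'') (pbB a' b' a'' b'') a b y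
      + pbB (pbA a'' a) (pbB a'' b'' a b) a' b' y = 0 := by
  have symm : ∀ {f : (Fin n → ℝ) → (Fin k → ℝ)}, ContDiff ℝ 2 f → ∀ v w,
      fderiv ℝ (fderiv ℝ f) y v w = fderiv ℝ (fderiv ℝ f) y w v := fun hf v w =>
    (hf.contDiffAt.isSymmSndFDerivAt (by simp)).eq v w
  rw [pbB_eq (pbA a a'), pbB_eq (pbA a' a''), pbB_eq (pbA a'' a)]
  simp only [fderiv_pbB_apply ha hb ha' hb', fderiv_pbB_apply ha' hb' ha'' hb'',
    fderiv_pbB_apply ha'' hb'' ha hb]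
  simp only [pbA_eq_pbB, pbB_eq, map_sub]
  rw [symm hb (a'' y) (a' y), symm hb' (a'' y) (a y), symm hb'' (a' y) (a y)]
  abel

/-- Jacobi identity for the polarized Poisson bracket. -/
theorem poisson_jacobi (k n : ℕ) (hk : 1 ≤ k) (hn : 1 ≤ n)
    (a a' a'' : (Fin n → ℝ) → (Fin n → ℝ)) (b b' b'' : (Fin n → ℝ) → (Fin k → ℝ))
    (ha : ContDiff ℝ (⊤ : ℕ∞) a) (hb : ContDiff ℝ (⊤ : ℕ∞) b)
    (ha' : ContDiff ℝ (⊤ : ℕ∞) a') (hb' : ContDiff ℝ (⊤ : ℕ∞) b')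
    (ha'' : ContDiff ℝ (⊤ : ℕ∞) a'') (hb'' : ContDiff ℝ (⊤ : ℕ∞) b'') :
    ∀ m : E k n,
      Ham (pbA (pbA a a') a'') (pbB (pbA a a') (pbB a b a' b') a'' b'') m
      + Ham (pbA (pbA a' a'') a) (pbB (pbA a' a'') (pbB a' b' a'' b'') a b) m
      + Ham (pbA (pbA a'' a) a') (pbB (pbA a'' a) (pbB a'' b'' a b) a' b') m = 0 := by
  intro m
  have two_le : (2 : WithTop ℕ∞) ≤ ((⊤ : ℕ∞) : WithTop ℕ∞) :=
    WithTop.coe_le_coe.2 (le_top : (2 : ℕ∞) ≤ ⊤)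
  replace ha := ha.of_le two_le
  replace hb := hb.of_le two_le
  replace ha' := ha'.of_le two_le
  replace hb' := hb'.of_le two_le
  replace ha'' := ha''.of_le two_le
  replace hb'' := hb''.of_le two_le
  funext p
  have hB := congrFun (pbB_jacobi ha hb ha' hb' ha'' hb'' m.2) p
  have hA : ∀ j, pbA (pbA a a') a'' m.2 j + pbA (pbA a' a'') a m.2 j
      + pbA (pbA a'' a) a' m.2 j = 0 :=
    congrFun (pbB_jacobi ha ha ha' ha' ha'' ha'' m.2)
  have hS : ∑ j, pbA (pbA a a') a'' m.2 j * m.1 p j + ∑ j, pbA (pbA a' a'') a m.2 j * m.1 p j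
      + ∑ j, pbA (pbA a'' a) a' m.2 j * m.1 p j = 0 := by
    simp only [← Finset.sum_add_distrib, ← add_mul, hA, zero_mul, Finset.sum_const_zero]
  simp only [Pi.add_apply, Pi.zero_apply, Ham] at hB ⊢
  linarith
end
end

section
/- The polarized Poisson bracket is the derivative along the other Hamiltonian vector field: for smooth a, b, a', b', writing H = H_{a,b} and K = H_{a',b'}, for every m ∈ E and p ∈ Fin k, −θ_p(X_{a,b}(m), X_{a',b'}(m)) = (fderiv ℝ (fun m => H(m) p) m)(X_{a',b'}(m)) = −(fderiv ℝ (fun m => K(m) p) m)(X_{a,b}(m)). -/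
noncomputable section

theorem theta_antisymm (k n : ℕ) (p : Fin k) (w v : E k n) :
    -theta k n p w v = theta k n p v w := by
  simp only [theta, ← Finset.sum_neg_distrib, neg_sub]

/-- A continuous linear map on `Fin n → ℝ` is determined by its values on the coordinate axes. -/
theorem clm_pi_apply_eq_sum {n m : ℕ} (L : (Fin n → ℝ) →L[ℝ] (Fin m → ℝ)) (v : Fin n → ℝ)
    (i : Fin m) : L v i = ∑ s, v s * L (Pi.single s 1) i := by
  conv_lhs => rw [pi_eq_sum_univ' v]
  simp [map_sum, Finset.sum_apply]

theorem hasFDerivAt_Ham {k n : ℕ} {a : (Fin n → ℝ) → (Fin n → ℝ)}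
    {b : (Fin n → ℝ) → (Fin k → ℝ)} {m : E k n}
    (ha : DifferentiableAt ℝ a m.2) (hb : DifferentiableAt ℝ b m.2) (p : Fin k) :
    HasFDerivAt (fun m : E k n => Ham a b m p)
      (∑ j, (a m.2 j • ((ContinuousLinearMap.proj j).comp ((ContinuousLinearMap.proj p).comp
            (ContinuousLinearMap.fst ℝ (Fin k → Fin n → ℝ) (Fin n → ℝ))))
          + m.1 p j • ((ContinuousLinearMap.proj j).comp ((fderiv ℝ a m.2).comp
            (ContinuousLinearMap.snd ℝ (Fin k → Fin n → ℝ) (Fin n → ℝ)))))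
        + (ContinuousLinearMap.proj p).comp ((fderiv ℝ b m.2).comp
            (ContinuousLinearMap.snd ℝ (Fin k → Fin n → ℝ) (Fin n → ℝ)))) m := by
  have hsnd : HasFDerivAt (fun m : E k n => m.2) (ContinuousLinearMap.snd ℝ _ _) m :=
    hasFDerivAt_snd
  have hx (j : Fin n) : HasFDerivAt (fun m : E k n => m.1 p j)
      ((ContinuousLinearMap.proj j).comp ((ContinuousLinearMap.proj p).comp
        (ContinuousLinearMap.fst ℝ (Fin k → Fin n → ℝ) (Fin n → ℝ)))) m :=
    hasFDerivAt_pi'.1 (hasFDerivAt_pi'.1 hasFDerivAt_fst p) j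
  have hA := hasFDerivAt_pi'.1 (ha.hasFDerivAt.comp m hsnd)
  have hB := hasFDerivAt_pi'.1 (hb.hasFDerivAt.comp m hsnd)
  exact (HasFDerivAt.fun_sum fun j _ => (hA j).mul (hx j)).add (hB p)

/-- The Hamilton equation `dH_p = -θ_p(X_H, ·)`. -/
theorem fderiv_Ham_apply {k n : ℕ} {a : (Fin n → ℝ) → (Fin n → ℝ)}
    {b : (Fin n → ℝ) → (Fin k → ℝ)} {m : E k n}
    (ha : DifferentiableAt ℝ a m.2) (hb : DifferentiableAt ℝ b m.2) (p : Fin k) (v : E k n) :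
    fderiv ℝ (fun m => Ham a b m p) m v = -theta k n p (HamVF a b m) v := by
  have hswap : ∑ j, m.1 p j * fderiv ℝ a m.2 v.2 j
      = ∑ s, (∑ j, m.1 p j * fderiv ℝ a m.2 (Pi.single s 1) j) * v.2 s := by
    simp_rw [clm_pi_apply_eq_sum (fderiv ℝ a m.2) v.2, Finset.mul_sum, Finset.sum_mul]
    rw [Finset.sum_comm]
    exact Finset.sum_congr rfl fun _ _ => Finset.sum_congr rfl fun _ _ => by ring
  have hL : fderiv ℝ (fun m => Ham a b m p) m v
      = ∑ j, (a m.2 j * v.1 p j + m.1 p j * fderiv ℝ a m.2 v.2 j) + fderiv ℝ b m.2 v.2 p := by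
    rw [(hasFDerivAt_Ham ha hb p).fderiv]
    simp
  rw [hL, Finset.sum_add_distrib, hswap, clm_pi_apply_eq_sum (fderiv ℝ b m.2) v.2, theta,
    ← Finset.sum_neg_distrib, ← Finset.sum_add_distrib, ← Finset.sum_add_distrib]
  exact Finset.sum_congr rfl fun _ _ => by simp only [HamVF]; ring

/-- the polarized Poisson bracket is the derivative along the other
Hamiltonian vector field. -/
theorem poisson_as_derivative (k n : ℕ) (hk : 1 ≤ k) (hn : 1 ≤ n)
    (a a' : (Fin n → ℝ) → (Fin n → ℝ)) (b b' : (Fin n → ℝ) → (Fin k → ℝ))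
    (ha : ContDiff ℝ (⊤ : ℕ∞) a) (hb : ContDiff ℝ (⊤ : ℕ∞) b)
    (ha' : ContDiff ℝ (⊤ : ℕ∞) a') (hb' : ContDiff ℝ (⊤ : ℕ∞) b') :
    ∀ (m : E k n) (p : Fin k),
      -theta k n p (HamVF a b m) (HamVF a' b' m)
          = fderiv ℝ (fun m => Ham a b m p) m (HamVF a' b' m)
      ∧ -theta k n p (HamVF a b m) (HamVF a' b' m)
          = -(fderiv ℝ (fun m => Ham a' b' m p) m (HamVF a b m)) := by
  intro m p
  have hdiff {r : ℕ} {f : (Fin n → ℝ) → (Fin r → ℝ)} (hf : ContDiff ℝ (⊤ : ℕ∞) f) :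
      DifferentiableAt ℝ f m.2 := hf.differentiable (by simp) m.2
  rw [fderiv_Ham_apply (hdiff ha) (hdiff hb), fderiv_Ham_apply (hdiff ha') (hdiff hb'),
    theta_antisymm k n p (HamVF a' b' m), neg_inj]
  exact ⟨rfl, rfl⟩
end
end
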